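/- Let G be a simple graph whose maximum degree, counting only positive-weight edges, is Δ. Then the set of positive-weight edges of G can be partitioned into at most Δ + 1 matchings, and hence into at most Δ + 1 feasible sets; consequently the optimal coalition structure value is at most (Δ + 1) times the maximum over these matchings of their total weight. -/

import Mathlib

open scoped Classical
open Finset

/-- Value of a coalition structure (labelling `p`) in a weighted graph game. -/
noncomputable def gval {V : Type} [Fintype V] {α : Type} (G : SimpleGraph V)
    (w : Sym2 V → ℚ) (p : V → α) : ℚ :=
  ∑ e : Sym2 V, if e ∈ G.edgeSet ∧ (Sym2.map p e).IsDiag then w e else 0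

/-- A connected component of a graph of maximum degree at most two contains at most two
vertices of degree at most one. -/
theorem SimpleGraph.false_of_three_ends {V : Type*} [Fintype V] (G : SimpleGraph V)
    (h2 : ∀ v, G.degree v ≤ 2) {u v w : V} (huv : u ≠ v) (huw : u ≠ w) (hvw : v ≠ w)
    (hu : G.degree u ≤ 1) (hv : G.degree v ≤ 1) (hw : G.degree w ≤ 1)
    (ruv : G.Reachable u v) (ruw : G.Reachable u w) : False := by
  set c := G.connectedComponentMk u with hc
  have hconn : (G.induce c.supp).Connected := c.connected_toSimpleGraph
  have hcard := hconn.card_vert_le_card_edgeSet_add_one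
  have hsum := (G.induce c.supp).sum_degrees_eq_twice_card_edges
  have hdeg : ∀ z : c.supp, (G.induce c.supp).degree z ≤ G.degree z := by
    intro z
    rw [← SimpleGraph.card_neighborFinset_eq_degree, ← SimpleGraph.card_neighborFinset_eq_degree]
    refine Finset.card_le_card_of_injOn Subtype.val ?_ Subtype.val_injective.injOn
    intro t ht
    simpa using ht
  let u' : c.supp := ⟨u, by simp [hc]⟩
  let v' : c.supp := ⟨v, by simpa [hc] using ruv.symm⟩
  let w' : c.supp := ⟨w, by simpa [hc] using ruw.symm⟩
  have hT : ({u', v', w'} : Finset c.supp).card = 3 := by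
    rw [Finset.card_eq_three]
    exact ⟨u', v', w', by simpa [u', v'] using huv, by simpa [u', w'] using huw,
      by simpa [v', w'] using hvw, rfl⟩
  have hbound : ∑ z : c.supp, ((G.induce c.supp).degree z +
      if z ∈ ({u', v', w'} : Finset c.supp) then 1 else 0) ≤ ∑ _z : c.supp, 2 := by
    refine Finset.sum_le_sum fun z _ => ?_
    split_ifs with hz
    · have hz1 : G.degree z ≤ 1 := by
        simp only [Finset.mem_insert, Finset.mem_singleton] at hz
        rcases hz with rfl | rfl | rfl <;> assumption
      have := hdeg z
      omega
    · exact (hdeg z).trans (h2 z)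
  rw [Finset.sum_add_distrib, Finset.sum_ite_mem, Finset.univ_inter, Finset.sum_const, hT, hsum,
    Finset.sum_const, Finset.card_univ] at hbound
  rw [Nat.card_eq_fintype_card, Nat.card_eq_fintype_card] at hcard
  rw [← SimpleGraph.edgeFinset_card] at hcard
  simp only [smul_eq_mul] at hbound
  omega

/-- A proper partial edge coloring of `H`, given as a symmetric function of two vertices. -/
structure PartialEdgeColoring {V K : Type*} (H : SimpleGraph V) (C : V → V → Option K) :
    Prop where
  symm : ∀ u v, C u v = C v u
  adj : ∀ u v a, C u v = some a → H.Adj u v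
  inj : ∀ u v w a, C u v = some a → C u w = some a → v = w

/-- The color `a` does not occur at the vertex `v`. -/
def ColorMissing {V K : Type*} (C : V → V → Option K) (v : V) (a : K) : Prop :=
  ∀ u, C v u ≠ some a

/-- Give the pair `x`, `y` the color `a`. -/
noncomputable def setColor {V K : Type*} (C : V → V → Option K) (x y : V) (a : K) :
    V → V → Option K :=
  fun u v => if (u = x ∧ v = y) ∨ (u = y ∧ v = x) then some a else C u v

/-- Exchange the colors `a` and `b` at the vertices of `S`. -/
noncomputable def kempeSwap {V K : Type*} (C : V → V → Option K) (S : Set V) (a b : K) :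
    V → V → Option K :=
  fun u v => if u ∈ S then (C u v).map (Equiv.swap a b) else C u v

namespace PartialEdgeColoring

variable {V K : Type*} {H : SimpleGraph V} {C : V → V → Option K}

theorem setColor (hC : PartialEdgeColoring H C) {x y : V} {a : K} (hxy : H.Adj x y)
    (hx : ColorMissing C x a) (hy : ColorMissing C y a) :
    PartialEdgeColoring H (setColor C x y a) := by
  have hne := hxy.ne
  refine ⟨fun u v => ?_, fun u v b h => ?_, fun u v w b h h' => ?_⟩
  · have := hC.symm u v
    unfold _root_.setColor
    grind
  · unfold _root_.setColor at h
    split_ifs at h with h1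
    · rcases h1 with ⟨rfl, rfl⟩ | ⟨rfl, rfl⟩
      exacts [hxy, hxy.symm]
    · exact hC.adj u v b h
  · have := hC.inj u v w b
    unfold _root_.setColor at h h'
    unfold ColorMissing at hx hy
    grind

theorem kempeSwap (hC : PartialEdgeColoring H C) {S : Set V} {a b : K}
    (hS : ∀ u v, C u v = some a ∨ C u v = some b → u ∈ S → v ∈ S) :
    PartialEdgeColoring H (kempeSwap C S a b) := by
  have hout : ∀ u v, u ∈ S → v ∉ S → (C u v).map (Equiv.swap a b) = C u v := by
    intro u v hu hv
    cases h : C u v with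
    | none => rfl
    | some e =>
      have hea : e ≠ a := fun h' => hv (hS u v (Or.inl (h' ▸ h)) hu)
      have heb : e ≠ b := fun h' => hv (hS u v (Or.inr (h' ▸ h)) hu)
      simp [Equiv.swap_apply_of_ne_of_ne hea heb]
  refine ⟨fun u v => ?_, fun u v e h => ?_, fun u v w e h h' => ?_⟩
  · unfold _root_.kempeSwap
    have h1 := hout u v
    have h2 := hout v u
    have h3 := hC.symm u v
    split_ifs <;> simp_all
  · unfold _root_.kempeSwap at h
    split_ifs at h with h1
    · obtain ⟨f, hf, -⟩ := Option.map_eq_some_iff.1 h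
      exact hC.adj u v f hf
    · exact hC.adj u v e h
  · unfold _root_.kempeSwap at h h'
    split_ifs at h h' with h1
    · obtain ⟨f, hf, hfe⟩ := Option.map_eq_some_iff.1 h
      obtain ⟨g, hg, hge⟩ := Option.map_eq_some_iff.1 h'
      have : f = g := (Equiv.swap a b).injective (hfe.trans hge.symm)
      subst this
      exact hC.inj u v w f hf hg
    · exact hC.inj u v w e h h'

theorem kempeSwap_missing {S : Set V} {a b : K} {v : V} (hv : v ∈ S) (h : ColorMissing C v b) :
    ColorMissing (_root_.kempeSwap C S a b) v a := by
  intro u hu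
  simp only [_root_.kempeSwap, if_pos hv] at hu
  obtain ⟨f, hf, hfe⟩ := Option.map_eq_some_iff.1 hu
  have : f = b := by
    apply (Equiv.swap a b).injective
    simp [hfe]
  exact h u (this ▸ hf)

theorem kempeSwap_missing_of_ne {S : Set V} {a b e : K} {v : V} (ha : e ≠ a) (hb : e ≠ b)
    (h : ColorMissing C v e) : ColorMissing (_root_.kempeSwap C S a b) v e := by
  intro u hu
  unfold _root_.kempeSwap at hu
  split_ifs at hu
  · obtain ⟨f, hf, hfe⟩ := Option.map_eq_some_iff.1 hu
    have : f = e := by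
      apply (Equiv.swap a b).injective
      rw [hfe, Equiv.swap_apply_of_ne_of_ne ha hb]
    exact h u (this ▸ hf)
  · exact h u hu

theorem kempeSwap_missing_of_notMem {S : Set V} {a b e : K} {v : V} (hv : v ∉ S)
    (h : ColorMissing C v e) : ColorMissing (_root_.kempeSwap C S a b) v e := by
  intro u hu
  simp only [_root_.kempeSwap, if_neg hv] at hu
  exact h u hu

theorem kempeSwap_ne_none {S : Set V} {a b : K} {u v : V} (h : C u v ≠ none) :
    _root_.kempeSwap C S a b u v ≠ none := by
  unfold _root_.kempeSwap
  split_ifs <;> simpa using h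

theorem exists_missing [Fintype V] [Fintype K] (hC : PartialEdgeColoring H C) (v : V)
    (hv : H.degree v < Fintype.card K) : ∃ a, ColorMissing C v a := by
  by_contra! hcon
  simp only [ColorMissing, not_forall, not_not] at hcon
  choose f hf using hcon
  have : (Finset.univ : Finset K).card ≤ (H.neighborFinset v).card := by
    refine Finset.card_le_card_of_injOn f (fun a _ => ?_) fun a _ b _ hab => ?_
    · simpa using hC.adj v (f a) a (hf a)
    · have h1 := hf a
      rw [hab, hf b] at h1
      exact (Option.some.inj h1).symm
  rw [SimpleGraph.card_neighborFinset_eq_degree, Finset.card_univ] at this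
  omega

/-- The graph of the edges colored `a` or `b`. -/
def kempeGraph (hC : PartialEdgeColoring H C) (a b : K) : SimpleGraph V where
  Adj u v := C u v = some a ∨ C u v = some b
  symm := ⟨fun u v h => by rwa [hC.symm v u]⟩
  loopless := ⟨fun u h => by rcases h with h | h <;> exact H.irrefl (hC.adj u u _ h)⟩

theorem card_colored_le_one [Fintype V] (hC : PartialEdgeColoring H C) (u : V) (a : K) :
    (Finset.univ.filter fun v => C u v = some a).card ≤ 1 := by
  rw [Finset.card_le_one]
  intro v hv w hw
  exact hC.inj u v w a (by simpa using hv) (by simpa using hw)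

theorem degree_kempeGraph_le [Fintype V] (hC : PartialEdgeColoring H C) (a b : K) (u : V) :
    (hC.kempeGraph a b).degree u ≤ (Finset.univ.filter fun v => C u v = some a).card +
      (Finset.univ.filter fun v => C u v = some b).card := by
  rw [← SimpleGraph.card_neighborFinset_eq_degree]
  refine le_trans (Finset.card_le_card ?_) (Finset.card_union_le _ _)
  intro v hv
  have : (hC.kempeGraph a b).Adj u v := by simpa using hv
  simpa [kempeGraph] using this

theorem degree_kempeGraph_le_one [Fintype V] (hC : PartialEdgeColoring H C) {a b : K} {u : V}
    (h : ColorMissing C u a ∨ ColorMissing C u b) : (hC.kempeGraph a b).degree u ≤ 1 := by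
  have h0 : ∀ e, ColorMissing C u e → (Finset.univ.filter fun v => C u v = some e).card = 0 := by
    intro e he
    exact Finset.card_eq_zero.2 (Finset.filter_eq_empty_iff.2 fun v _ => he v)
  have := hC.degree_kempeGraph_le a b u
  have ha := hC.card_colored_le_one u a
  have hb := hC.card_colored_le_one u b
  rcases h with h | h <;> have := h0 _ h <;> omega

theorem kempeGraph_not_reachable [Fintype V] (hC : PartialEdgeColoring H C) {a b : K} {x y z : V}
    (hxy : x ≠ y) (hxz : x ≠ z) (hyz : y ≠ z)
    (hx : ColorMissing C x a ∨ ColorMissing C x b) (hy : ColorMissing C y a ∨ ColorMissing C y b)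
    (hz : ColorMissing C z a ∨ ColorMissing C z b)
    (rxy : (hC.kempeGraph a b).Reachable x y) : ¬ (hC.kempeGraph a b).Reachable x z := by
  refine fun rxz => (hC.kempeGraph a b).false_of_three_ends (fun u => ?_) hxy hxz hyz
    (hC.degree_kempeGraph_le_one hx) (hC.degree_kempeGraph_le_one hy)
    (hC.degree_kempeGraph_le_one hz) rxy rxz
  have := hC.degree_kempeGraph_le a b u
  have ha := hC.card_colored_le_one u a
  have hb := hC.card_colored_le_one u b
  omega

end PartialEdgeColoring

/-- `y 0, …, y m` is a Vizing fan at `x`: the vertices are distinct, and the color of each edge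
`x y_{i+1}` is missing at `y_i`. -/
structure IsFan {V K : Type*} (C : V → V → Option K) (x : V) (y : ℕ → V) (m : ℕ) : Prop where
  inj : ∀ i ≤ m, ∀ j ≤ m, y i = y j → i = j
  color : ∀ i < m, ∃ a, C x (y (i + 1)) = some a ∧ ColorMissing C (y i) a

namespace PartialEdgeColoring

variable {V K : Type*} {H : SimpleGraph V}

/-- A fan whose last vertex misses a color that is also missing at the center can be shifted, so
that its first edge becomes colored. -/
theorem exists_extension_of_isFan {x : V} {y : ℕ → V} (m : ℕ) {C : V → V → Option K}
    (hC : PartialEdgeColoring H C) (hy : IsFan C x y m) (hadj : H.Adj x (y 0))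
    (hmiss : ∃ a, ColorMissing C x a ∧ ColorMissing C (y m) a) :
    ∃ C' : V → V → Option K, PartialEdgeColoring H C' ∧ (∀ u v, C u v ≠ none → C' u v ≠ none) ∧
      C' x (y 0) ≠ none := by
  have hset : ∀ (C : V → V → Option K) x y a u v, C u v ≠ none →
      _root_.setColor C x y a u v ≠ none := by
    intro C x y a u v h
    unfold _root_.setColor
    split_ifs <;> simp [h]
  induction m generalizing C with
  | zero =>
    obtain ⟨a, hxa, hya⟩ := hmiss
    exact ⟨_, hC.setColor hadj hxa hya, hset C _ _ a, by simp [_root_.setColor]⟩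
  | succ m ih =>
    obtain ⟨a, hxa, hya⟩ := hmiss
    obtain ⟨b, hb, hmb⟩ := hy.color m (Nat.lt_succ_self m)
    have hadj' := hC.adj _ _ _ hb
    have hne : ∀ i ≤ m, y i ≠ y (m + 1) := fun i hi h => by
      have := hy.inj i (by omega) (m + 1) le_rfl h
      omega
    have hab : a ≠ b := fun h => hxa _ (h ▸ hb)
    have hyx : ∀ i ≤ m, y i ≠ x := by
      intro i hi h
      rcases i with - | i
      · exact hadj.ne h.symm
      · obtain ⟨e, he, -⟩ := hy.color i (by omega)
        exact (hC.adj _ _ _ he).ne h.symm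
    have hkeep : ∀ i ≤ m, ∀ e, ColorMissing C (y i) e →
        ColorMissing (_root_.setColor C x (y (m + 1)) a) (y i) e := fun i hi e he u hu =>
      he u (by simpa [_root_.setColor, hyx i hi, hne i hi] using hu)
    obtain ⟨C', h1, h2, h3⟩ := ih (hC.setColor hadj' hxa hya)
      ⟨fun i hi j hj => hy.inj i (by omega) j (by omega), fun i hi => by
        obtain ⟨e, he, hme⟩ := hy.color i (by omega)
        refine ⟨e, ?_, hkeep i (by omega) e hme⟩
        simpa [_root_.setColor, hne (i + 1) (by omega), hadj'.ne] using he⟩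
      ⟨b, fun u hu => by
        by_cases huy : u = y (m + 1)
        · simp [_root_.setColor, huy, hab] at hu
        · simp only [_root_.setColor, huy, hadj'.ne] at hu
          exact huy (hC.inj x u _ b (by simpa using hu) hb), hkeep m le_rfl b hmb⟩
    exact ⟨C', h1, fun u v h => h2 u v (hset C _ _ a u v h), h3⟩

/-- If the Kempe component of the last vertex of a fan avoids the center and does not affect the
fan condition, exchanging the two colors on it makes the fan shiftable. -/
theorem exists_extension_of_kempeSwap {x : V} {y : ℕ → V} (m : ℕ) {C : V → V → Option K}
    (hC : PartialEdgeColoring H C) (hy : IsFan C x y m) (hadj : H.Adj x (y 0)) {c d : K}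
    (hc : ColorMissing C x c) (hd : ColorMissing C (y m) d)
    (hr : ¬ (hC.kempeGraph c d).Reachable (y m) x)
    (hfan : ∀ i < m, C x (y (i + 1)) = some d → ¬ (hC.kempeGraph c d).Reachable (y m) (y i)) :
    ∃ C' : V → V → Option K, PartialEdgeColoring H C' ∧ (∀ u v, C u v ≠ none → C' u v ≠ none) ∧
      C' x (y 0) ≠ none := by
  let S : Set V := {v | (hC.kempeGraph c d).Reachable (y m) v}
  have hS : ∀ u v, C u v = some c ∨ C u v = some d → u ∈ S → v ∈ S := fun u v h hu =>
    SimpleGraph.Reachable.trans hu (SimpleGraph.Adj.reachable (G := hC.kempeGraph c d) h)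
  have hx : x ∉ S := hr
  obtain ⟨C', h1, h2, h3⟩ := exists_extension_of_isFan m (hC.kempeSwap hS)
    (y := y) (x := x) ⟨hy.inj, fun i hi => by
      obtain ⟨e, he, hme⟩ := hy.color i hi
      refine ⟨e, by simpa [_root_.kempeSwap, hx] using he, ?_⟩
      by_cases hed : e = d
      · exact kempeSwap_missing_of_notMem (hfan i hi (hed ▸ he)) hme
      · exact kempeSwap_missing_of_ne (fun h => hc _ (h ▸ he)) hed hme⟩ hadj
    ⟨c, kempeSwap_missing_of_notMem hx hc,
      kempeSwap_missing (SimpleGraph.Reachable.refl (y m)) hd⟩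
  exact ⟨C', h1, fun u v h => h2 u v (kempeSwap_ne_none h), h3⟩

theorem exists_extension [Fintype V] [Fintype K] {C : V → V → Option K}
    (hdeg : ∀ v, H.degree v < Fintype.card K) (hC : PartialEdgeColoring H C) {x y₀ : V}
    (hadj : H.Adj x y₀) (hnone : C x y₀ = none) :
    ∃ C' : V → V → Option K, PartialEdgeColoring H C' ∧ (∀ u v, C u v ≠ none → C' u v ≠ none) ∧
      C' x y₀ ≠ none := by
  by_contra hcon
  obtain ⟨c, hc⟩ := hC.exists_missing x (hdeg x)
  have hlong : ∀ m, ∃ y : ℕ → V, y 0 = y₀ ∧ IsFan C x y m := by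
    intro m
    induction m with
    | zero => exact ⟨fun _ => y₀, rfl, fun i hi j hj _ => by omega, fun i hi => by omega⟩
    | succ m ih =>
      obtain ⟨y, rfl, hy⟩ := ih
      obtain ⟨d, hd⟩ := hC.exists_missing (y m) (hdeg _)
      by_cases hxd : ColorMissing C x d
      · exact absurd (exists_extension_of_isFan m hC hy hadj ⟨d, hxd, hd⟩) hcon
      obtain ⟨z, hz⟩ : ∃ z, C x z = some d := by simpa [ColorMissing] using hxd
      by_cases hzy : ∃ j ≤ m, y j = z
      · exfalso
        obtain ⟨j, hj, rfl⟩ := hzy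
        rcases j with - | j
        · simp [hnone] at hz
        obtain ⟨e, he, hme⟩ := hy.color j hj
        obtain rfl : e = d := Option.some.inj (he.symm.trans hz)
        have hyx : ∀ i ≤ m, x ≠ y i := by
          intro i hi
          rcases i with - | i
          · exact hadj.ne
          · obtain ⟨f, hf, -⟩ := hy.color i (by omega)
            exact (hC.adj _ _ _ hf).ne
        by_cases hr : (hC.kempeGraph c e).Reachable x (y j)
        · have hr' := hC.kempeGraph_not_reachable (hyx j (by omega)) (hyx m le_rfl)
            (fun h => by have := hy.inj j (by omega) m le_rfl h; omega)
            (Or.inl hc) (Or.inr hme) (Or.inr hd) hr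
          refine hcon (exists_extension_of_kempeSwap m hC hy hadj hc hd (fun h => hr' h.symm)
            fun i hi h hri => hr' ?_)
          have := hy.inj _ (by omega) _ (by omega) (hC.inj x _ _ e h hz)
          obtain rfl : i = j := by omega
          exact hr.trans hri.symm
        · refine hcon (exists_extension_of_kempeSwap j hC ⟨fun i hi k hk => hy.inj i (by omega) k
            (by omega), fun i hi => hy.color i (by omega)⟩ hadj hc hme (fun h => hr h.symm)
            fun i hi h => ?_)
          have := hy.inj _ (by omega) _ (by omega) (hC.inj x _ _ e h hz)
          omega
      · push Not at hzy
        refine ⟨fun i => if i ≤ m then y i else z, by simp, fun i hi j hj h => ?_, fun i hi => ?_⟩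
        · by_cases h1 : i ≤ m <;> by_cases h2 : j ≤ m <;> simp only [h1, h2, if_true, if_false] at h
          · exact hy.inj i h1 j h2 h
          · exact absurd h (hzy i h1)
          · exact absurd h.symm (hzy j h2)
          · omega
        · have him : i ≤ m := by omega
          by_cases h1 : i + 1 ≤ m
          · simpa [h1, him] using hy.color i h1
          · obtain rfl : i = m := by omega
            exact ⟨d, by simpa using hz, by simpa using hd⟩
  obtain ⟨y, -, hy⟩ := hlong (Fintype.card V)
  have := Fintype.card_le_of_injective (fun i : Fin (Fintype.card V + 1) => y i) fun i j h =>
    Fin.ext (hy.inj i (by omega) j (by omega) h)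
  simp at this

/-- Vizing's theorem. -/
theorem exists_total [Fintype V] [Fintype K] (hdeg : ∀ v, H.degree v < Fintype.card K) :
    ∃ C : V → V → Option K, PartialEdgeColoring H C ∧ ∀ u v, H.Adj u v → C u v ≠ none := by
  let colored (C : V → V → Option K) : Finset (V × V) :=
    Finset.univ.filter fun p => C p.1 p.2 ≠ none
  obtain ⟨C, hC, hmax⟩ := Set.exists_max_image {C : V → V → Option K | PartialEdgeColoring H C}
    (fun C => (colored C).card) (Set.toFinite _)
    ⟨fun _ _ => none, fun _ _ => rfl, by simp, by simp⟩
  refine ⟨C, hC, fun u v huv hnone => ?_⟩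
  obtain ⟨C', hC', hsub, hnew⟩ := hC.exists_extension hdeg huv hnone
  refine (hmax C' hC').not_gt (Finset.card_lt_card (Finset.ssubset_iff_subset_ne.2 ⟨?_, ?_⟩))
  · intro p hp
    simpa [colored] using hsub _ _ (by simpa [colored] using hp)
  · intro h
    have : (u, v) ∈ colored C' := by simpa [colored] using hnew
    rw [← h] at this
    simp [colored, hnone] at this

/-- Vizing's theorem, as a partition of the edge set into matchings. -/
theorem exists_matchings [Fintype V] [Fintype K] (hdeg : ∀ v, H.degree v < Fintype.card K) :
    ∃ M : K → Finset (Sym2 V), (∀ i, ∀ e ∈ M i, e ∈ H.edgeSet) ∧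
      (∀ i, ∀ e ∈ M i, ∀ f ∈ M i, e ≠ f → ∀ v : V, v ∈ e → v ∉ f) ∧
      ∀ e ∈ H.edgeSet, ∃! i, e ∈ M i := by
  obtain ⟨C, hC, htot⟩ := exists_total hdeg
  obtain ⟨M, hM⟩ : ∃ M : K → Finset (Sym2 V), ∀ u v i, s(u, v) ∈ M i ↔ C u v = some i := by
    refine ⟨fun i => Finset.univ.filter fun e => ∃ u v, e = s(u, v) ∧ C u v = some i,
      fun u v i => ?_⟩
    simp only [Finset.mem_filter, Finset.mem_univ, true_and]
    refine ⟨?_, fun h => ⟨u, v, rfl, h⟩⟩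
    rintro ⟨u', v', h, h'⟩
    rcases Sym2.eq_iff.1 h with ⟨rfl, rfl⟩ | ⟨rfl, rfl⟩
    · exact h'
    · rwa [hC.symm]
  refine ⟨M, fun i e he => ?_, fun i e he f hf hef v hve hvf => ?_, fun e he => ?_⟩
  · induction e with
    | _ u v => exact hC.adj u v i ((hM u v i).1 he)
  · obtain ⟨a, rfl⟩ := Sym2.mem_iff_exists.1 hve
    obtain ⟨b, rfl⟩ := Sym2.mem_iff_exists.1 hvf
    exact hef (by rw [hC.inj v a b i ((hM v a i).1 he) ((hM v b i).1 hf)])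
  · induction e with
    | _ u v =>
      obtain ⟨i, hi⟩ := Option.ne_none_iff_exists'.1 (htot u v he)
      refine ⟨i, (hM u v i).2 hi, fun j hj => ?_⟩
      exact Option.some.inj (((hM u v j).1 hj).symm.trans hi)

end PartialEdgeColoring

/-- If every vertex of `G` is incident to at most `Δ` positive-weight edges,
then the positive edges of `G` can be partitioned into `Δ + 1` matchings
(feasible sets), and the value of every coalition structure is at most
`(Δ + 1)` times the total weight of the heaviest of these matchings. -/
theorem vizing_approximation {V : Type} [Fintype V]
    (G : SimpleGraph V) (w : Sym2 V → ℚ) (Δ : ℕ)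
    (hΔ : ∀ v : V, (Finset.univ.filter
      (fun u : V => G.Adj v u ∧ 0 < w s(v, u))).card ≤ Δ) :
    ∃ M : Fin (Δ + 1) → Finset (Sym2 V),
      (∀ i, ∀ e ∈ M i, e ∈ G.edgeSet ∧ 0 < w e) ∧
      (∀ i, ∀ e ∈ M i, ∀ f ∈ M i, e ≠ f → ∀ v : V, v ∈ e → v ∉ f) ∧
      (∀ e : Sym2 V, e ∈ G.edgeSet → 0 < w e → ∃! i, e ∈ M i) ∧
      ∃ i : Fin (Δ + 1), ∀ p : V → ℕ,
        gval G w p ≤ (Δ + 1 : ℚ) * ∑ e ∈ M i, w e := by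
  obtain ⟨H, hH⟩ : ∃ H : SimpleGraph V, ∀ u v, H.Adj u v ↔ G.Adj u v ∧ 0 < w s(u, v) :=
    ⟨{ Adj := fun u v => G.Adj u v ∧ 0 < w s(u, v)
       symm := ⟨fun u v h => ⟨h.1.symm, by rw [Sym2.eq_swap]; exact h.2⟩⟩
       loopless := ⟨fun u h => G.irrefl h.1⟩ }, fun u v => Iff.rfl⟩
  have hedge : ∀ e, e ∈ H.edgeSet ↔ e ∈ G.edgeSet ∧ 0 < w e := by
    intro e
    induction e with
    | _ u v => exact hH u v
  have hdeg : ∀ v, H.degree v < Fintype.card (Fin (Δ + 1)) := by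
    intro v
    rw [Fintype.card_fin, Nat.lt_succ_iff, ← SimpleGraph.card_neighborFinset_eq_degree]
    refine le_trans (Finset.card_le_card fun u hu => ?_) (hΔ v)
    simpa [hH] using hu
  obtain ⟨M, hMH, hmatch, huniq⟩ := PartialEdgeColoring.exists_matchings hdeg
  have hpos : ∀ i, ∀ e ∈ M i, e ∈ G.edgeSet ∧ 0 < w e := fun i e he => (hedge e).1 (hMH i e he)
  have hex : ∀ e : Sym2 V, e ∈ G.edgeSet → 0 < w e → ∃! i, e ∈ M i := fun e he hwe =>
    huniq e ((hedge e).2 ⟨he, hwe⟩)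
  refine ⟨M, hpos, hmatch, hex, ?_⟩
  obtain ⟨i, -, hi⟩ := Finset.exists_max_image Finset.univ (fun i => ∑ e ∈ M i, w e)
    (Finset.univ_nonempty (α := Fin (Δ + 1)))
  refine ⟨i, fun p => ?_⟩
  calc gval G w p ≤ ∑ e : Sym2 V, ∑ j, if e ∈ M j then w e else 0 := by
        refine Finset.sum_le_sum fun e _ => ?_
        have hnonneg : ∀ j ∈ Finset.univ, 0 ≤ if e ∈ M j then w e else 0 := fun j _ => by
          split_ifs with h
          exacts [(hpos j e h).2.le, le_rfl]
        split_ifs with h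
        · by_cases hwe : 0 < w e
          · obtain ⟨j, hj, -⟩ := hex e h.1 hwe
            have := Finset.single_le_sum hnonneg (Finset.mem_univ j)
            rwa [if_pos hj] at this
          · exact (not_lt.1 hwe).trans (Finset.sum_nonneg hnonneg)
        · exact Finset.sum_nonneg hnonneg
    _ = ∑ j, ∑ e ∈ M j, w e := by
        rw [Finset.sum_comm]
        simp
    _ ≤ ∑ _j : Fin (Δ + 1), ∑ e ∈ M i, w e := Finset.sum_le_sum fun j hj => hi j hj
    _ = (Δ + 1 : ℚ) * ∑ e ∈ M i, w e := by simp
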